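/- Let X₁,…,X₁₀ be positive reals each less than 2.2636302 with X₁ > 1 and product 1. Suppose Xᵢ > 1 for i ∈ {3, 5, 8, 9, 10}, X₂ ≤ X₁, X₄ ≤ X₃, and Xᵢ ≤ X₁X₅ for i ∈ {8, 9, 10}. Then 4X₁ - 2X₁²/X₂ + 4X₃ - 2X₃²/X₄ + 4X₅ - X₅³/(X₆X₇) + X₈ + X₉ + X₁₀ ≤ 10. -/

import Mathlib

def ClaimW (a c P R : ℝ) : Prop :=
  ∀ u v w : ℝ, 2 * a ≤ u → 2 * c ≤ v → 0 < w → u * v * w = P → R ≤ u + v + w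

/-- move mass from `u` to `w` -/
theorem balOne (U T u w : ℝ) (hT : 0 < T) (hU : T ≤ U) (hw : 0 < w) (hwT : w < T) (hu : U ≤ u) :
    ∃ u' w', U ≤ u' ∧ 0 < w' ∧ u' * w' = u * w ∧ u' + w' ≤ u + w ∧
      (T ≤ w' ∨ (u' = U ∧ w' < T)) := by
  have hu0 : 0 < u := by linarith
  have hU0 : 0 < U := by linarith
  by_cases h : U ≤ u * w / T
  · refine ⟨u * w / T, T, h, hT, by field_simp, ?_, Or.inl le_rfl⟩
    have : T ≤ u := by linarith
    have h2 : u * w / T + T - (u + w) = - ((u - T) * (T - w)) / T := by field_simp; ring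
    have h3 : 0 ≤ (u - T) * (T - w) / T :=
      div_nonneg (mul_nonneg (by linarith) (by linarith)) hT.le
    rw [neg_div] at h2
    linarith
  · push Not at h
    rw [div_lt_iff₀ hT] at h
    have hlt : u * w / U < T := by rw [div_lt_iff₀ hU0]; linarith
    refine ⟨U, u * w / U, le_rfl, by positivity, by field_simp, ?_, Or.inr ⟨rfl, hlt⟩⟩
    have h2 : U + u * w / U - (u + w) = - ((u - U) * (U - w)) / U := by field_simp; ring
    have h3 : 0 ≤ (u - U) * (U - w) / U :=
      div_nonneg (mul_nonneg (by linarith) (by linarith)) hU0.le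
    rw [neg_div] at h2
    linarith

theorem bal (a c T u v w : ℝ) (ha : 0 < a) (hc : 0 < c) (hT : 0 < T) (hw : 0 < w)
    (hu : 2 * a ≤ u) (hv : 2 * c ≤ v)
    (hP : max (2 * a) T * max (2 * c) T * T ≤ u * v * w) :
    ∃ u' v' w', 2 * a ≤ u' ∧ 2 * c ≤ v' ∧ T ≤ w' ∧ u' * v' * w' = u * v * w ∧
      u' + v' + w' ≤ u + v + w := by
  by_cases hwT : T ≤ w
  · exact ⟨u, v, w, hu, hv, hwT, rfl, le_rfl⟩
  push Not at hwT
  have key : ∀ u v w : ℝ, 0 < u → 0 < v → 0 < w → u ≤ max (2 * a) T → v ≤ max (2 * c) T → w < T →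
      u * v * w < max (2 * a) T * max (2 * c) T * T := by
    intro u v w hu0 hv0 hw0 h1 h2 h3
    have h4 : u * v ≤ max (2 * a) T * max (2 * c) T :=
      mul_le_mul h1 h2 hv0.le (hu0.le.trans h1)
    calc u * v * w < u * v * T := by gcongr
      _ ≤ _ := by gcongr
  have hu0 : 0 < u := by linarith
  have hv0 : 0 < v := by linarith
  have hUa := le_max_left (2 * a) T
  have hUT := le_max_right (2 * a) T
  have hVc := le_max_left (2 * c) T
  have hVT := le_max_right (2 * c) T
  -- first step
  have s1 : ∃ u' w', 2 * a ≤ u' ∧ 0 < w' ∧ u' * w' = u * w ∧ u' + w' ≤ u + w ∧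
      (T ≤ w' ∨ (u' ≤ max (2 * a) T ∧ w' < T)) := by
    by_cases h : u ≤ max (2 * a) T
    · exact ⟨u, w, hu, hw, rfl, le_rfl, Or.inr ⟨h, hwT⟩⟩
    · obtain ⟨u', w', h1, h2, h3, h4, h5⟩ := balOne _ T u w hT hUT hw hwT (not_le.1 h).le
      refine ⟨u', w', hUa.trans h1, h2, h3, h4, ?_⟩
      rcases h5 with h5 | ⟨h5, h6⟩
      · exact Or.inl h5
      · exact Or.inr ⟨h5.le, h6⟩
  obtain ⟨u', w', h1, h2, h3, h4, h5⟩ := s1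
  have e1 : u' * v * w' = u * v * w := by linear_combination v * h3
  have hu'0 : 0 < u' := by linarith
  rcases h5 with h5 | ⟨h5, h6⟩
  · exact ⟨u', v, w', h1, hv, h5, e1, by linarith⟩
  by_cases h : v ≤ max (2 * c) T
  · have := key u' v w' hu'0 hv0 h2 h5 h h6
    linarith
  obtain ⟨v', w'', g1, g2, g3, g4, g5⟩ := balOne _ T v w' hT hVT h2 h6 (not_le.1 h).le
  have e2 : u' * v' * w'' = u * v * w := by linear_combination u' * g3 + e1
  rcases g5 with g5 | ⟨g5, g6⟩
  · exact ⟨u', v', w'', h1, hVc.trans g1, g5, e2, by linarith⟩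
  · have := key u' v' w'' hu'0 (by linarith) g2 h5 g5.le g6
    linarith

theorem stepW (a c N R x T : ℝ) (ha : 0 < a) (hc : 0 < c) (hT : 0 < T) (hx : 1 ≤ x)
    (h1 : 2 * a * (2 * c) * T ≤ N * x) (h2 : 2 * a * T * T ≤ N * x)
    (h3 : 2 * c * T * T ≤ N * x) (h4 : T * T * T ≤ N * x)
    (H : ClaimW a c N R) : ClaimW a c (N * x) (R + T * (1 - 1 / x)) := by
  intro u v w hu hv hw he
  have hx0 : 0 < x := by linarith
  have hP : max (2 * a) T * max (2 * c) T * T ≤ u * v * w := by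
    rw [he]
    rcases max_choice (2 * a) T with h | h <;> rcases max_choice (2 * c) T with h' | h' <;>
      rw [h, h'] <;> linarith
  obtain ⟨u', v', w', g1, g2, g3, g4, g5⟩ := bal a c T u v w ha hc hT hw hu hv hP
  have hw' : 0 < w' := by linarith
  have := H u' v' (w' / x) g1 g2 (by positivity) (by
    rw [he] at g4; field_simp; linarith)
  have h6 : T * (1 - 1 / x) ≤ w' * (1 - 1 / x) := by
    apply mul_le_mul_of_nonneg_right g3
    rw [sub_nonneg, div_le_one hx0]; exact hx
  have h7 : w' * (1 - 1 / x) = w' - w' / x := by ring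
  linarith

theorem base_aux (a c p q k t w : ℝ) (ha : 1 ≤ a) (hc : 1 ≤ c) (hp : 0 ≤ p) (hpq : p ≤ q)
    (hk : k = (1 + p) * (1 + q)) (ht : t = a * c) (hw : 0 < w) (hwk : w * k = t ^ 2) :
    2 * a * (1 - p) + 2 * c * (1 - q) ≤ 3 + w := by
  by_cases h1 : 1 ≤ p
  · nlinarith
  push Not at h1
  have hac : a + c ≤ 1 + t := by nlinarith
  have s1 : a * (1 - p) + c * (1 - q) ≤ (1 - p) * t + (1 - q) := by
    nlinarith [mul_nonneg (sub_nonneg.2 hac) (sub_nonneg.2 h1.le),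
      mul_nonneg (sub_nonneg.2 hpq) (sub_nonneg.2 hc)]
  have hk0 : 0 < k := by rw [hk]; have : 0 ≤ q := hp.trans hpq; positivity
  have s2 : 2 * t * (1 - p) ≤ w + (1 - p) ^ 2 * k := by
    have : 0 ≤ (t - (1 - p) * k) ^ 2 := sq_nonneg _
    have h5 : 0 ≤ k * (w + (1 - p) ^ 2 * k - 2 * t * (1 - p)) := by nlinarith
    have := nonneg_of_mul_nonneg_right h5 hk0
    linarith
  have s3 : (1 - p) ^ 2 * k ≤ 1 + 2 * q := by
    have h6 : (1 - p) ^ 2 * (1 + p) ≤ 1 := by nlinarith [mul_nonneg hp (sub_nonneg.2 h1.le), mul_nonneg (mul_nonneg hp hp) (sub_nonneg.2 h1.le)]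
    have : (1 - p) ^ 2 * (1 + p) * (1 + q) ≤ 1 * (1 + q) := by
      apply mul_le_mul_of_nonneg_right h6; linarith
    rw [hk]; nlinarith
  linarith

theorem base (a c : ℝ) (ha : 1 ≤ a) (hc : 1 ≤ c) :
    ClaimW a c (4 * a ^ 3 * c ^ 3) (4 * a + 4 * c - 3) := by
  intro u v w hu hv hw he
  obtain ⟨p, rfl⟩ : ∃ p, u = 2 * a * (1 + p) := ⟨u / (2 * a) - 1, by field_simp; ring⟩
  obtain ⟨q, rfl⟩ : ∃ q, v = 2 * c * (1 + q) := ⟨v / (2 * c) - 1, by field_simp; ring⟩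
  have hp : 0 ≤ p := by
    by_contra h; push Not at h; nlinarith
  have hq : 0 ≤ q := by
    by_contra h; push Not at h; nlinarith
  have hk : w * ((1 + p) * (1 + q)) = (a * c) ^ 2 := by
    have : (4 * a * c) ≠ 0 := by positivity
    apply mul_left_cancel₀ this
    linear_combination he
  rcases le_total p q with h | h
  · have := base_aux a c p q _ _ w ha hc hp h rfl rfl hw hk
    linarith
  · have := base_aux c a q p _ _ w hc ha hq h rfl rfl hw (by rw [mul_comm c a]; linarith)
    linarith

theorem stepX (a c e D R y : ℝ) (ha : 1 ≤ a) (hc : 1 ≤ c) (he : 1 ≤ e) (hD : e ^ 4 ≤ D)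
    (hy : 1 ≤ y) (hya : y ≤ a * e) (H : ClaimW a c (4 * a ^ 3 * c ^ 3 * D) R) :
    ClaimW a c (4 * a ^ 3 * c ^ 3 * D * y) (R + y - 1) := by
  have hD2 : e ^ 2 ≤ D := (pow_le_pow_right₀ he (by norm_num)).trans hD
  have hD1 : e ≤ D := (by simpa using pow_le_pow_right₀ he (show 1 ≤ 4 by norm_num) : e ≤ e ^ 4).trans hD
  have c3 : 1 ≤ c ^ 3 := one_le_pow₀ hc
  have c31 : c ≤ c ^ 3 := by simpa using pow_le_pow_right₀ hc (show 1 ≤ 3 by norm_num)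
  have a31 : a ≤ a ^ 3 := by simpa using pow_le_pow_right₀ ha (show 1 ≤ 3 by norm_num)
  have a32 : a ^ 2 ≤ a ^ 3 := pow_le_pow_right₀ ha (by norm_num)
  have hA : a ^ 2 * e ^ 2 ≤ a ^ 3 * c ^ 3 * D := by
    calc a ^ 2 * e ^ 2 = a ^ 2 * 1 * e ^ 2 := by ring
      _ ≤ _ := by gcongr
  have hB : a ^ 2 * e ≤ a ^ 3 * c ^ 3 * D := by
    calc a ^ 2 * e = a ^ 2 * 1 * e := by ring
      _ ≤ _ := by gcongr
  have hC : a * c * e ≤ a ^ 3 * c ^ 3 * D := by gcongr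
  have hE : a * c ≤ a * c * e := by nlinarith [mul_pos (by linarith : 0 < a) (by linarith : 0 < c)]
  have hN : 0 ≤ a ^ 3 * c ^ 3 * D := by have : 0 ≤ D := by linarith
                                        positivity
  have h := stepW a c _ R y y (by linarith) (by linarith) (by linarith) hy
    (by have : a * c ≤ a ^ 3 * c ^ 3 * D := hE.trans hC
        calc _ = 4 * (a * c) * y := by ring
          _ ≤ 4 * (a ^ 3 * c ^ 3 * D) * y := by gcongr
          _ = _ := by ring)
    (by calc _ = 2 * a * y * y := by ring
          _ ≤ 2 * a * (a * e) * y := by gcongr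
          _ = 2 * (a ^ 2 * e) * y := by ring
          _ ≤ 4 * (a ^ 3 * c ^ 3 * D) * y := by gcongr; linarith
          _ = _ := by ring)
    (by calc _ = 2 * c * y * y := by ring
          _ ≤ 2 * c * (a * e) * y := by gcongr
          _ = 2 * (a * c * e) * y := by ring
          _ ≤ 4 * (a ^ 3 * c ^ 3 * D) * y := by gcongr; linarith
          _ = _ := by ring)
    (by calc _ = y * y * y := by ring
          _ ≤ (a * e) * (a * e) * y := by gcongr
          _ = 1 * (a ^ 2 * e ^ 2) * y := by ring
          _ ≤ 4 * (a ^ 3 * c ^ 3 * D) * y := by gcongr; norm_num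
          _ = _ := by ring) H
  have hy0 : y ≠ 0 := by positivity
  have : R + y * (1 - 1 / y) = R + y - 1 := by field_simp; ring
  rwa [this] at h

/-- step in e with T = l e -/
theorem stepE (a c e D R l : ℝ) (ha : 1 ≤ a) (hc : 1 ≤ c) (he : 1 ≤ e) (hl : 0 < l) (hD : 1 ≤ D)
    (h1 : l ≤ D) (h2 : l * l * e ≤ 2 * D) (h3 : l * l * l * e * e ≤ 4 * D)
    (H : ClaimW a c (4 * a ^ 3 * c ^ 3 * D) R) :
    ClaimW a c (4 * a ^ 3 * c ^ 3 * (D * e)) (R + l * (e - 1)) := by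
  have c3 : 1 ≤ c ^ 3 := one_le_pow₀ hc
  have a3 : 1 ≤ a ^ 3 := one_le_pow₀ ha
  have c31 : c ≤ c ^ 3 := by simpa using pow_le_pow_right₀ hc (show 1 ≤ 3 by norm_num)
  have a31 : a ≤ a ^ 3 := by simpa using pow_le_pow_right₀ ha (show 1 ≤ 3 by norm_num)
  have h := stepW a c _ R e (l * e) (by linarith) (by linarith) (by positivity) he
    (by calc _ = 4 * a * c * l * e := by ring
          _ ≤ 4 * a ^ 3 * c ^ 3 * D * e := by gcongr)
    (by calc _ = 2 * a * 1 * (l * l * e) * e := by ring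
          _ ≤ 2 * a ^ 3 * c ^ 3 * (2 * D) * e := by gcongr
          _ = _ := by ring)
    (by calc _ = 2 * 1 * c * (l * l * e) * e := by ring
          _ ≤ 2 * a ^ 3 * c ^ 3 * (2 * D) * e := by gcongr
          _ = _ := by ring)
    (by calc _ = 1 * 1 * (l * l * l * e * e) * e := by ring
          _ ≤ a ^ 3 * c ^ 3 * (4 * D) * e := by gcongr
          _ = _ := by ring) H
  have : R + l * e * (1 - 1 / e) = R + l * (e - 1) := by field_simp
  rw [this, mul_assoc] at h
  exact h

theorem claimE (a c e : ℝ) (ha : 1 ≤ a) (hc : 1 ≤ c) (he : 1 ≤ e) (he2 : e ≤ 2.2636302) :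
    ClaimW a c (4 * a ^ 3 * c ^ 3 * (1 * e * e * e * e)) (4 * a + 4 * c + 4 * e - 7) := by
  have H0 := base a c ha hc
  have e2 : 1 ≤ e * e := by nlinarith
  have e3 : 1 ≤ e * e * e := by nlinarith
  have H0' : ClaimW a c (4 * a ^ 3 * c ^ 3 * 1) (4 * a + 4 * c - 3) := by rwa [mul_one]
  rcases le_total e 2 with h | h
  · have H1 := stepE a c e 1 _ 1 ha hc he one_pos le_rfl (by nlinarith) (by nlinarith) (by nlinarith) H0'
    have H2 := stepE a c e _ _ 1 ha hc he one_pos (by nlinarith) (by nlinarith) (by nlinarith) (by nlinarith) H1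
    have H3 := stepE a c e _ _ 1 ha hc he one_pos (by nlinarith) (by nlinarith) (by nlinarith) (by nlinarith) H2
    have H4 := stepE a c e _ _ 1 ha hc he one_pos (by nlinarith) (by nlinarith) (by nlinarith) (by nlinarith) H3
    intro u v w hu hv hw hh
    have := H4 u v w hu hv hw hh
    linarith
  · have H1 := stepE a c e 1 _ (2/5) ha hc he (by norm_num) le_rfl (by nlinarith) (by nlinarith) (by nlinarith) H0'
    have H2 := stepE a c e _ _ (6/5) ha hc he (by norm_num) (by nlinarith) (by nlinarith) (by nlinarith) (by nlinarith) H1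
    have H3 := stepE a c e _ _ (6/5) ha hc he (by norm_num) (by nlinarith) (by nlinarith) (by nlinarith) (by nlinarith) H2
    have H4 := stepE a c e _ _ (6/5) ha hc he (by norm_num) (by nlinarith) (by nlinarith) (by nlinarith) (by nlinarith) H3
    intro u v w hu hv hw hh
    have := H4 u v w hu hv hw hh
    linarith


theorem stmt_14 (X₁ X₂ X₃ X₄ X₅ X₆ X₇ X₈ X₉ X₁₀ : ℝ)
    (hpos : 0 < X₁ ∧ 0 < X₂ ∧ 0 < X₃ ∧ 0 < X₄ ∧ 0 < X₅ ∧ 0 < X₆ ∧ 0 < X₇ ∧ 0 < X₈ ∧ 0 < X₉ ∧ 0 < X₁₀)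
    (hub : X₁ < 2.2636302 ∧ X₂ < 2.2636302 ∧ X₃ < 2.2636302 ∧ X₄ < 2.2636302 ∧ X₅ < 2.2636302 ∧
      X₆ < 2.2636302 ∧ X₇ < 2.2636302 ∧ X₈ < 2.2636302 ∧ X₉ < 2.2636302 ∧ X₁₀ < 2.2636302)
    (h1 : 1 < X₁)
    (hprod : X₁ * X₂ * X₃ * X₄ * X₅ * X₆ * X₇ * X₈ * X₉ * X₁₀ = 1)
    (hgt : 1 < X₃ ∧ 1 < X₅ ∧ 1 < X₈ ∧ 1 < X₉ ∧ 1 < X₁₀)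
    (h21 : X₂ ≤ X₁) (h43 : X₄ ≤ X₃)
    (h8 : X₈ ≤ X₁ * X₅) (h9 : X₉ ≤ X₁ * X₅) (h10 : X₁₀ ≤ X₁ * X₅) :
    4 * X₁ - 2 * X₁ ^ 2 / X₂ + 4 * X₃ - 2 * X₃ ^ 2 / X₄ +
      4 * X₅ - X₅ ^ 3 / (X₆ * X₇) + X₈ + X₉ + X₁₀ ≤ 10 := by
  obtain ⟨p1, p2, p3, p4, p5, p6, p7, p8, p9, p10⟩ := hpos
  obtain ⟨g3, g5, g8, g9, g10⟩ := hgt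
  have hE := claimE X₁ X₃ X₅ h1.le g3.le g5.le hub.2.2.2.2.1.le
  have e4 : X₅ ^ 4 = 1 * X₅ * X₅ * X₅ * X₅ := by ring
  have q5 : 0 < 1 * X₅ * X₅ * X₅ * X₅ := by positivity
  have l8 : 1 * X₅ * X₅ * X₅ * X₅ ≤ 1 * X₅ * X₅ * X₅ * X₅ * X₈ := le_mul_of_one_le_right q5.le g8.le
  have l9 : 1 * X₅ * X₅ * X₅ * X₅ * X₈ ≤ 1 * X₅ * X₅ * X₅ * X₅ * X₈ * X₉ :=
    le_mul_of_one_le_right (by positivity) g9.le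
  have H8 := stepX X₁ X₃ X₅ _ _ X₈ h1.le g3.le g5.le e4.le g8.le h8 hE
  rw [mul_assoc (4 * X₁ ^ 3 * X₃ ^ 3)] at H8
  have H9 := stepX X₁ X₃ X₅ _ _ X₉ h1.le g3.le g5.le (e4.le.trans l8) g9.le h9 H8
  rw [mul_assoc (4 * X₁ ^ 3 * X₃ ^ 3)] at H9
  have H10 := stepX X₁ X₃ X₅ _ _ X₁₀ h1.le g3.le g5.le (e4.le.trans (l8.trans l9)) g10.le h10 H9
  have := H10 (2 * X₁ ^ 2 / X₂) (2 * X₃ ^ 2 / X₄) (X₅ ^ 3 / (X₆ * X₇))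
    (by rw [le_div_iff₀ p2]; nlinarith) (by rw [le_div_iff₀ p4]; nlinarith) (by positivity)
    (by
      have hne : X₂ * X₄ * (X₆ * X₇) ≠ 0 := by positivity
      have : 2 * X₁ ^ 2 / X₂ * (2 * X₃ ^ 2 / X₄) * (X₅ ^ 3 / (X₆ * X₇))
        = (4 * X₁ ^ 2 * X₃ ^ 2 * X₅ ^ 3) / (X₂ * X₄ * (X₆ * X₇)) := by
        field_simp; norm_num
      rw [this, div_eq_iff hne]
      linear_combination (-4 * X₁ ^ 2 * X₃ ^ 2 * X₅ ^ 3) * hprod)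
  linarith
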